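/- arXiv:2103.11240 — 4 statements merged into one kernel-verified Lean document; each statement's English description precedes it below -/
import Mathlib

section
/- Consider the garbled FSM evaluation. Define the true state sequence q : Fin (n+1) → ZMod m by q 0 = q₀ and q (i+1) = δ (q i) (x i). Define the client's evaluation sequence by p 0 = q₀ + r 0 and κ̂ 0 = k 0 (p 0), and for each i : Fin n, (p (i+1), κ̂ (i+1)) := G i (p i) (x i) - H (κ̂ i) (x i), where the subtraction is componentwise (subtraction in ZMod m in the first component, addition in (ZMod 2)^κ in the second). Then for every index i : Fin (n+1), the invariant p i = q i + r i and κ̂ i = k (i) (q i + r i) holds; in particular the client's ungarbling at every step recovers the correct permuted next state together with the correct key for it. -/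
/-- Correctness invariant of the garbled FSM evaluation: at every step the client
holds the correct permuted state `q i + r i` and the correct key for it. -/
theorem garbled_fsm_invariant
    (m n κ : ℕ) (hm : 1 ≤ m) (Alpha : Type*)
    (δ : ZMod m → Alpha → ZMod m) (q₀ : ZMod m) (x : Fin n → Alpha)
    (r : Fin (n + 1) → ZMod m)
    (k : Fin (n + 1) → ZMod m → (Fin κ → ZMod 2))
    (H : (Fin κ → ZMod 2) → Alpha → ZMod m × (Fin κ → ZMod 2))
    (G : Fin n → ZMod m → Alpha → ZMod m × (Fin κ → ZMod 2))
    (hG : ∀ (i : Fin n) (q : ZMod m) (σ : Alpha),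
      G i q σ =
        ((H (k i.castSucc q) σ).1 + (δ (q - r i.castSucc) σ + r i.succ),
         (H (k i.castSucc q) σ).2 + k i.succ (δ (q - r i.castSucc) σ + r i.succ)))
    -- the true state sequence
    (q : Fin (n + 1) → ZMod m) (hq0 : q 0 = q₀)
    (hq : ∀ i : Fin n, q i.succ = δ (q i.castSucc) (x i))
    -- the client's evaluation sequence
    (p : Fin (n + 1) → ZMod m) (κ' : Fin (n + 1) → Fin κ → ZMod 2)
    (hp0 : p 0 = q₀ + r 0) (hκ0 : κ' 0 = k 0 (p 0))
    (hstep : ∀ i : Fin n,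
      (p i.succ, κ' i.succ) = G i (p i.castSucc) (x i) - H (κ' i.castSucc) (x i)) :
    ∀ i : Fin (n + 1), p i = q i + r i ∧ κ' i = k i (q i + r i) := by
  intro i
  induction i using Fin.induction with
  | zero => exact ⟨by rw [hp0, hq0], by rw [hκ0, hp0, hq0]⟩
  | succ i ih =>
    have h := hstep i
    rw [hG, ih.2, ih.1, add_sub_cancel_right, ← hq] at h
    simpa [Prod.ext_iff] using h
end

section
/- Consider the garbled FSM evaluation with masked acceptance output, and assume n ≥ 1. Define the true state sequence q : Fin (n+1) → ZMod m by q 0 = q₀ and q (i+1) = δ (q i) (x i), and the client's evaluation sequence p, κ̂ by p 0 = q₀ + r 0, κ̂ 0 = k 0 (p 0), and (p (i+1), κ̂ (i+1)) := G i (p i) (x i) - H (κ̂ i) (x i) for i < n - 1. Let A ⊆ ZMod m be the set of accept states, let ρ : ZMod M (with M ≥ 2) be the server's random output mask, let H_out : K → Σ → ZMod M be an arbitrary function, and replace the final garbled entries by G' q σ := H_out (k (n-1) q) σ + (ρ + (if δ (q - r (n-1)) σ ∈ A then 1 else 0)). Then the client's final value z := G' (p (n-1)) (x (n-1)) - H_out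 (κ̂ (n-1)) (x (n-1)) satisfies z = ρ + (if q n ∈ A then 1 else 0); that is, z minus the server's mask ρ equals 1 if the FSM accepts the input string x and equals 0 otherwise. -/
/-- Correctness of the garbled FSM evaluation with masked acceptance output:
the client's final value equals the server's mask `ρ` plus the acceptance bit. -/
theorem garbled_fsm_masked_output
    (m n κ M : ℕ) (hm : 1 ≤ m) (hn : 1 ≤ n) (hM : 2 ≤ M) (Alpha : Type*)
    (δ : ZMod m → Alpha → ZMod m) (q₀ : ZMod m) (x : Fin n → Alpha)
    (r : Fin (n + 1) → ZMod m)
    (k : Fin (n + 1) → ZMod m → (Fin κ → ZMod 2))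
    (H : (Fin κ → ZMod 2) → Alpha → ZMod m × (Fin κ → ZMod 2))
    (G : Fin n → ZMod m → Alpha → ZMod m × (Fin κ → ZMod 2))
    (hG : ∀ (i : Fin n) (q : ZMod m) (σ : Alpha),
      G i q σ =
        ((H (k i.castSucc q) σ).1 + (δ (q - r i.castSucc) σ + r i.succ),
         (H (k i.castSucc q) σ).2 + k i.succ (δ (q - r i.castSucc) σ + r i.succ)))
    -- the true state sequence
    (q : Fin (n + 1) → ZMod m) (hq0 : q 0 = q₀)
    (hq : ∀ i : Fin n, q i.succ = δ (q i.castSucc) (x i))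
    -- the client's evaluation sequence (only up to step n - 1)
    (p : Fin (n + 1) → ZMod m) (κ' : Fin (n + 1) → Fin κ → ZMod 2)
    (hp0 : p 0 = q₀ + r 0) (hκ0 : κ' 0 = k 0 (p 0))
    (hstep : ∀ i : Fin n, (i : ℕ) < n - 1 →
      (p i.succ, κ' i.succ) = G i (p i.castSucc) (x i) - H (κ' i.castSucc) (x i))
    -- the masked-output final garbled entries
    (A : Set (ZMod m)) [DecidablePred (· ∈ A)]
    (ρ : ZMod M) (Hout : (Fin κ → ZMod 2) → Alpha → ZMod M)
    (G' : ZMod m → Alpha → ZMod M)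
    (hG' : ∀ (qs : ZMod m) (σ : Alpha),
      G' qs σ = Hout (k ⟨n - 1, by omega⟩ qs) σ +
        (ρ + if δ (qs - r ⟨n - 1, by omega⟩) σ ∈ A then 1 else 0))
    -- the client's final value
    (z : ZMod M)
    (hz : z = G' (p ⟨n - 1, by omega⟩) (x ⟨n - 1, by omega⟩) -
      Hout (κ' ⟨n - 1, by omega⟩) (x ⟨n - 1, by omega⟩)) :
    z = ρ + if q (Fin.last n) ∈ A then 1 else 0 := by
  have invariant : ∀ (j : ℕ) (hj : j ≤ n - 1),
      p ⟨j, by omega⟩ = q ⟨j, by omega⟩ + r ⟨j, by omega⟩ ∧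
        κ' ⟨j, by omega⟩ = k ⟨j, by omega⟩ (p ⟨j, by omega⟩) := by
    intro j
    induction j with
    | zero => exact fun _ => ⟨hp0.trans (by rw [← hq0]; rfl), hκ0⟩
    | succ j ih =>
      intro hj
      obtain ⟨hp, hκ⟩ := ih (by omega)
      have hs := hstep ⟨j, by omega⟩ (by simp only; omega)
      have ht := hq ⟨j, by omega⟩
      simp only [Fin.castSucc_mk, Fin.succ_mk] at hs ht
      rw [hG, hκ] at hs
      simp only [Fin.castSucc_mk, Fin.succ_mk, Prod.ext_iff, Prod.fst_sub, Prod.snd_sub,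
        add_sub_cancel_left] at hs
      obtain ⟨hs₁, hs₂⟩ := hs
      refine ⟨?_, by rw [hs₂, hs₁]⟩
      rw [hs₁, ht, hp, add_sub_cancel_right]
  obtain ⟨hp, hκ⟩ := invariant (n - 1) le_rfl
  have hlast : q (Fin.last n) = δ (q ⟨n - 1, by omega⟩) (x ⟨n - 1, by omega⟩) := by
    rw [← Fin.castSucc_mk n (n - 1) (by omega), ← hq]
    congr 1
    ext
    simp only [Fin.val_last, Fin.succ_mk]
    omega
  rw [hz, hG', hκ, add_sub_cancel_left, hp, add_sub_cancel_right, ← hlast]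
end

section
/- Consider the garbled finite-state transducer. Let λ : ZMod m → Σ → ZMod g be the output rule (a Mealy-machine output function with outputs in ZMod g, g ≥ 1), let z : Fin n → ZMod g be the server's per-step random output masks, and let H_λ : K → Σ → ZMod g be an arbitrary function. Append to each garbled entry the masked output value O i q σ := H_λ (k i q) σ + (z i + λ (q - r i) σ). Define the true state sequence q : Fin (n+1) → ZMod m by q 0 = q₀ and q (i+1) = δ (q i) (x i), and the client's evaluation sequence p, κ̂ by p 0 = q₀ + r 0, κ̂ 0 = k 0 (p 0), and (p (i+1), κ̂ (i+1)) := G i (p i) (x i) - H (κ̂ i) (x i). Then for every step i : Fin n, the client's recovered output value o i := O i (p i) (x i) - H_λ (κ̂ i) (x i) satisfies o i = z i + λ (q i) (x i); that is, the client obtains exactly the true transducer output at step i masked by the server's mask z i. -/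
/-- Correctness of the garbled finite-state transducer: at every step the client
recovers exactly the true (Mealy) transducer output masked by the server's mask. -/
theorem garbled_fst_output_correct
    (m n κ g : ℕ) (hm : 1 ≤ m) (hg : 1 ≤ g) (Alpha : Type*)
    (δ : ZMod m → Alpha → ZMod m) (q₀ : ZMod m) (x : Fin n → Alpha)
    (r : Fin (n + 1) → ZMod m)
    (k : Fin (n + 1) → ZMod m → (Fin κ → ZMod 2))
    (H : (Fin κ → ZMod 2) → Alpha → ZMod m × (Fin κ → ZMod 2))
    (G : Fin n → ZMod m → Alpha → ZMod m × (Fin κ → ZMod 2))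
    (hG : ∀ (i : Fin n) (q : ZMod m) (σ : Alpha),
      G i q σ =
        ((H (k i.castSucc q) σ).1 + (δ (q - r i.castSucc) σ + r i.succ),
         (H (k i.castSucc q) σ).2 + k i.succ (δ (q - r i.castSucc) σ + r i.succ)))
    -- the transducer output rule, per-step masks, output hash and masked outputs
    (lam : ZMod m → Alpha → ZMod g)
    (z : Fin n → ZMod g)
    (Hlam : (Fin κ → ZMod 2) → Alpha → ZMod g)
    (O : Fin n → ZMod m → Alpha → ZMod g)
    (hO : ∀ (i : Fin n) (q : ZMod m) (σ : Alpha),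
      O i q σ = Hlam (k i.castSucc q) σ + (z i + lam (q - r i.castSucc) σ))
    -- the true state sequence
    (q : Fin (n + 1) → ZMod m) (hq0 : q 0 = q₀)
    (hq : ∀ i : Fin n, q i.succ = δ (q i.castSucc) (x i))
    -- the client's evaluation sequence
    (p : Fin (n + 1) → ZMod m) (κ' : Fin (n + 1) → Fin κ → ZMod 2)
    (hp0 : p 0 = q₀ + r 0) (hκ0 : κ' 0 = k 0 (p 0))
    (hstep : ∀ i : Fin n,
      (p i.succ, κ' i.succ) = G i (p i.castSucc) (x i) - H (κ' i.castSucc) (x i))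
    -- the client's recovered output values
    (o : Fin n → ZMod g)
    (ho : ∀ i : Fin n, o i = O i (p i.castSucc) (x i) - Hlam (κ' i.castSucc) (x i)) :
    ∀ i : Fin n, o i = z i + lam (q i.castSucc) (x i) := by
  have state_key : ∀ i, p i = q i + r i ∧ κ' i = k i (p i) := by
    intro i
    induction i using Fin.induction with
    | zero => exact ⟨by rw [hp0, hq0], hκ0⟩
    | succ i ih =>
      obtain ⟨hp, hκ⟩ := ih
      have h := hstep i
      rw [hκ, hG, Prod.ext_iff] at h
      simp only [Prod.fst_sub, Prod.snd_sub, add_sub_cancel_left] at h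
      obtain ⟨h_fst, h_snd⟩ := h
      refine ⟨?_, by rw [h_snd, h_fst]⟩
      rw [h_fst, hp, add_sub_cancel_right, hq]
  intro i
  obtain ⟨hp, hκ⟩ := state_key i.castSucc
  rw [ho, hO, hκ, add_sub_cancel_left, hp, add_sub_cancel_right]
end

section
/- Correctness of the three-party column reconstruction: let Σ be a finite type, u : Σ, and let s, h : Σ → ZMod 2 be XOR secret shares of the one-hot encoding of u, i.e., for every j : Σ, s j + h j = (if j = u then 1 else 0) in ZMod 2. Let c : Σ → (Fin L → ZMod 2) assign to each symbol a column (a bit vector of length L, with XOR given by addition in (ZMod 2)^L), and let M : Fin L → ZMod 2 be an arbitrary masking vector. Then the XOR of the server's masked partial answer and the helper's masked partial answer equals the selected column: (∑_{j ∈ {j : Σ | s j = 1}} c j + M) + (∑_{j ∈ {j : Σ | h j = 1}} c j + M) = c u. -/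
/-- Over `ZMod 2`, summing over the support of a bit vector is taking the linear combination
with that bit vector as coefficients. -/
theorem sum_filter_eq_one_eq_sum_smul {ι V : Type*} [Fintype ι] [AddCommGroup V]
    [Module (ZMod 2) V] (s : ι → ZMod 2) (c : ι → V) :
    ∑ j ∈ Finset.univ.filter (fun j => s j = 1), c j = ∑ j, s j • c j := by
  rw [Finset.sum_filter]
  refine Finset.sum_congr rfl fun j _ => ?_
  have key : ∀ a : ZMod 2, a = 0 ∨ a = 1 := by decide
  rcases key (s j) with hj | hj <;> simp [hj]

/-- Correctness of the three-party column reconstruction: the XOR of the server's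
and the helper's masked partial answers equals the selected column `c u`. -/
theorem three_party_column_reconstruction
    (Alpha : Type*) [Fintype Alpha] [DecidableEq Alpha] (u : Alpha)
    (s h : Alpha → ZMod 2)
    (hsh : ∀ j : Alpha, s j + h j = if j = u then 1 else 0)
    (L : ℕ) (c : Alpha → (Fin L → ZMod 2)) (M : Fin L → ZMod 2) :
    ((∑ j ∈ Finset.univ.filter (fun j => s j = 1), c j) + M) +
      ((∑ j ∈ Finset.univ.filter (fun j => h j = 1), c j) + M) = c u := by
  have hM : M + M = 0 := funext fun i => CharTwo.add_self_eq_zero (M i)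
  rw [add_add_add_comm, hM, add_zero, sum_filter_eq_one_eq_sum_smul,
    sum_filter_eq_one_eq_sum_smul, ← Finset.sum_add_distrib]
  simp [← add_smul, hsh]
end
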